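/- Let f_L, f_R : ℝ^d → ℝ^d (d ≥ 1) be C^1 maps that agree on the switching manifold Σ = {x ∈ ℝ^d : x_1 = 0}, define f : ℝ^d → ℝ^d by f(x) = f_L(x) if x_1 ≤ 0 and f(x) = f_R(x) if x_1 ≥ 0, and suppose f(0) = 0. Let A_L = Df_L(0), A_R = Df_R(0), and define the piecewise-linear map g : ℝ^d → ℝ^d by g(x) = A_L x if x_1 ≤ 0 and g(x) = A_R x if x_1 ≥ 0. If 0 is an asymptotically stable fixed point of g, then 0 is an asymptotically stable fixed point of f. -/

import Mathlib

open Metric Filter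

/-- `0` is an asymptotically stable fixed point: Lyapunov stability together with
local attraction. -/
def AsympStableAtZero {d : ℕ} (f : EuclideanSpace ℝ (Fin d) → EuclideanSpace ℝ (Fin d)) : Prop :=
  (∀ ε > (0 : ℝ), ∃ δ > (0 : ℝ), ∀ x ∈ ball (0 : EuclideanSpace ℝ (Fin d)) δ,
      ∀ i : ℕ, f^[i] x ∈ ball (0 : EuclideanSpace ℝ (Fin d)) ε) ∧
  (∃ δ > (0 : ℝ), ∀ x ∈ ball (0 : EuclideanSpace ℝ (Fin d)) δ,
      Tendsto (fun n : ℕ => f^[n] x) atTop (nhds (0 : EuclideanSpace ℝ (Fin d))))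

open Asymptotics Topology

section NormedSpace

variable {E : Type*} [NormedAddCommGroup E] [NormedSpace ℝ E]

/-- Iterates of a positively homogeneous map are positively homogeneous. -/
theorem iterate_smul_of_pos_homogeneous {g : E → E}
    (hg : ∀ c : ℝ, 0 ≤ c → ∀ x, g (c • x) = c • g x) (i : ℕ) {c : ℝ} (hc : 0 ≤ c) (x : E) :
    g^[i] (c • x) = c • g^[i] x := by
  induction i generalizing x with
  | zero => rfl
  | succ i ih => simp only [Function.iterate_succ_apply, hg c hc, ih]

/-- Lyapunov stability of a positively homogeneous map bounds all iterates linearly. -/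
theorem exists_iterate_norm_le_of_pos_homogeneous {g : E → E}
    (hg : ∀ c : ℝ, 0 ≤ c → ∀ x, g (c • x) = c • g x) {δ : ℝ} (hδ : 0 < δ)
    (h : ∀ x ∈ ball (0 : E) δ, ∀ i : ℕ, g^[i] x ∈ ball (0 : E) 1) :
    ∃ M > 0, ∀ x, ∀ i : ℕ, ‖g^[i] x‖ ≤ M * ‖x‖ := by
  refine ⟨2 / δ, by positivity, fun x i => ?_⟩
  rcases eq_or_ne x 0 with rfl | hx
  · have := iterate_smul_of_pos_homogeneous hg i le_rfl (0 : E)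
    simp_all
  have hx' : 0 < ‖x‖ := norm_pos_iff.2 hx
  have hc : 0 < δ / (2 * ‖x‖) := by positivity
  have hmem : (δ / (2 * ‖x‖)) • x ∈ ball (0 : E) δ := by
    rw [mem_ball_zero_iff, norm_smul, Real.norm_of_nonneg hc.le]
    field_simp
    linarith
  have := h _ hmem i
  rw [iterate_smul_of_pos_homogeneous hg i hc.le, mem_ball_zero_iff, norm_smul,
    Real.norm_of_nonneg hc.le] at this
  field_simp at this ⊢
  linarith

/-- An asymptotically stable positively homogeneous map has a contracting iterate. -/
theorem exists_iterate_contracting_of_pos_homogeneous [ProperSpace E] {g : E → E}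
    (hgc : Continuous g) (hg : ∀ c : ℝ, 0 ≤ c → ∀ x, g (c • x) = c • g x)
    {M : ℝ} (hM : 0 < M) (hbound : ∀ x, ∀ i : ℕ, ‖g^[i] x‖ ≤ M * ‖x‖)
    {δ : ℝ} (hδ : 0 < δ)
    (hattr : ∀ x ∈ ball (0 : E) δ, Tendsto (fun n : ℕ => g^[n] x) atTop (𝓝 0)) :
    ∃ N > 0, ∀ x, ‖g^[N] x‖ ≤ 1 / 4 * ‖x‖ := by
  obtain ⟨n, hn⟩ := (isCompact_sphere (0 : E) 1).elim_directed_cover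
    (fun n : ℕ => {x | ∃ i ≤ n, ‖g^[i] x‖ < 1 / (4 * M)})
    (fun n => by
      have : {x | ∃ i ≤ n, ‖g^[i] x‖ < 1 / (4 * M)} =
          ⋃ i, ⋃ (_ : i ≤ n), {x | ‖g^[i] x‖ < 1 / (4 * M)} := by ext; simp
      rw [this]
      exact isOpen_iUnion fun i => isOpen_iUnion fun _ =>
        isOpen_lt (hgc.iterate i).norm continuous_const)
    (fun x hx => by
      have hx1 : ‖x‖ = 1 := by simpa using hx
      have hlim := hattr ((δ / 2) • x) (by
        rw [mem_ball_zero_iff, norm_smul, hx1, Real.norm_of_nonneg (by positivity)]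
        linarith)
      have hsmall := (Metric.tendsto_nhds.1 hlim) (δ / 2 * (1 / (4 * M))) (by positivity)
      obtain ⟨i, hi⟩ := hsmall.exists
      rw [iterate_smul_of_pos_homogeneous hg i (by positivity), dist_zero_right, norm_smul,
        Real.norm_of_nonneg (by positivity)] at hi
      exact Set.mem_iUnion.2 ⟨i, i, le_rfl, lt_of_mul_lt_mul_left hi (by positivity)⟩)
    (directed_of_isDirected_le fun a b hab x ⟨i, hi, h⟩ => ⟨i, hi.trans hab, h⟩)
  refine ⟨n + 1, n.succ_pos, fun x => ?_⟩
  rcases eq_or_ne x 0 with rfl | hx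
  · simpa using hbound 0 (n + 1)
  have hx' : 0 < ‖x‖ := norm_pos_iff.2 hx
  obtain ⟨i, hi, hlt⟩ := hn (show ‖x‖⁻¹ • x ∈ sphere (0 : E) 1 by
    simp [norm_smul, hx'.ne'])
  rw [iterate_smul_of_pos_homogeneous hg i (by positivity), norm_smul,
    Real.norm_of_nonneg (by positivity)] at hlt
  have hsplit := hbound (g^[i] x) (n + 1 - i)
  rw [← Function.iterate_add_apply, Nat.sub_add_cancel (by omega)] at hsplit
  have hlt' : M * ‖g^[i] x‖ ≤ 1 / 4 * ‖x‖ := by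
    field_simp at hlt ⊢
    linarith
  exact hsplit.trans hlt'

end NormedSpace

section NormedAddCommGroup

variable {E : Type*} [NormedAddCommGroup E]

/-- If `f` agrees with a Lipschitz map `g` fixing `0` to first order at `0`, so do the iterates. -/
theorem isLittleO_iterate_sub_iterate {f g : E → E} {K : NNReal} (hK : LipschitzWith K g)
    (hg0 : g 0 = 0) (hfg : (fun x => f x - g x) =o[𝓝 0] (fun x => x)) (i : ℕ) :
    (fun x => f^[i] x - g^[i] x) =o[𝓝 0] (fun x => x) ∧
      (fun x => f^[i] x) =O[𝓝 0] (fun x => x) := by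
  have hgO (i : ℕ) : (fun x => g^[i] x) =O[𝓝 0] (fun x => x) := by
    refine IsBigO.of_bound ((K ^ i : NNReal) : ℝ) (Eventually.of_forall fun x => ?_)
    have := (hK.iterate i).dist_le_mul x 0
    rwa [Function.iterate_fixed hg0, dist_zero_right, dist_zero_right] at this
  suffices h : (fun x => f^[i] x - g^[i] x) =o[𝓝 0] (fun x => x) from
    ⟨h, by simpa using h.isBigO.add (hgO i)⟩
  induction i with
  | zero => simp
  | succ i ih =>
    have hfO : (fun x => f^[i] x) =O[𝓝 0] (fun x => x) := by
      simpa using ih.isBigO.add (hgO i)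
    have hlim : Tendsto (fun x => f^[i] x) (𝓝 0) (𝓝 0) := hfO.trans_tendsto tendsto_id
    have hfirst : (fun x => f (f^[i] x) - g (f^[i] x)) =o[𝓝 0] (fun x => x) :=
      (hfg.comp_tendsto hlim).trans_isBigO hfO
    have hsecond : (fun x => g (f^[i] x) - g (g^[i] x)) =o[𝓝 0] (fun x => x) := by
      refine IsBigO.trans_isLittleO (IsBigO.of_bound (K : ℝ) (Eventually.of_forall fun x => ?_)) ih
      simpa [dist_eq_norm] using hK.dist_le_mul (f^[i] x) (g^[i] x)
    simpa [Function.iterate_succ_apply'] using hfirst.add hsecond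

/-- A locally contracting iterate yields geometric decay of orbits near `0`. -/
theorem exists_iterate_norm_le_geometric {f : E → E} {N : ℕ}
    (hO : ∀ i : ℕ, (fun x => f^[i] x) =O[𝓝 0] (fun x => x))
    (hN : ∀ᶠ x in 𝓝 (0 : E), ‖f^[N] x‖ ≤ 1 / 2 * ‖x‖) :
    ∃ δ > 0, ∃ C > 0, ∀ x ∈ ball (0 : E) δ, ∀ k : ℕ, ∀ r < N,
      ‖f^[r + N * k] x‖ ≤ C * (1 / 2) ^ k * ‖x‖ := by
  choose c hcpos hc using fun i => (hO i).exists_pos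
  have hall : ∀ᶠ x in 𝓝 (0 : E),
      ‖f^[N] x‖ ≤ 1 / 2 * ‖x‖ ∧ ∀ r ∈ Finset.range N, ‖f^[r] x‖ ≤ c r * ‖x‖ :=
    hN.and ((Finset.eventually_all _).2 fun r _ => (hc r).bound)
  obtain ⟨δ, hδ, hball⟩ := Metric.eventually_nhds_iff_ball.1 hall
  have hsum : 0 ≤ ∑ r ∈ Finset.range N, c r := Finset.sum_nonneg fun r _ => (hcpos r).le
  refine ⟨δ, hδ, ∑ r ∈ Finset.range N, c r + 1, by positivity, fun x hx k r hr => ?_⟩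
  have hpow : ‖(f^[N])^[k] x‖ ≤ (1 / 2) ^ k * ‖x‖ := by
    induction k with
    | zero => simp
    | succ k ih =>
      have hmem : (f^[N])^[k] x ∈ ball (0 : E) δ := by
        rw [mem_ball_zero_iff] at hx ⊢
        refine (ih.trans (mul_le_of_le_one_left (norm_nonneg x) ?_)).trans_lt hx
        exact pow_le_one₀ (by norm_num) (by norm_num)
      rw [Function.iterate_succ_apply', pow_succ]
      linarith [(hball _ hmem).1]
  have hmem : (f^[N])^[k] x ∈ ball (0 : E) δ := by
    rw [mem_ball_zero_iff] at hx ⊢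
    refine (hpow.trans (mul_le_of_le_one_left (norm_nonneg x) ?_)).trans_lt hx
    exact pow_le_one₀ (by norm_num) (by norm_num)
  have hcr : c r ≤ ∑ r ∈ Finset.range N, c r + 1 :=
    (Finset.single_le_sum (fun r _ => (hcpos r).le) (Finset.mem_range.2 hr)).trans (by linarith)
  rw [Function.iterate_add_apply, Function.iterate_mul, mul_assoc]
  calc ‖f^[r] ((f^[N])^[k] x)‖ ≤ c r * ‖(f^[N])^[k] x‖ :=
        (hball _ hmem).2 r (Finset.mem_range.2 hr)
    _ ≤ _ := mul_le_mul hcr hpow (norm_nonneg _) (by positivity)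

end NormedAddCommGroup

/-- A map with a locally contracting iterate is asymptotically stable at `0`. -/
theorem asympStableAtZero_of_iterate_contracting {d : ℕ}
    {f : EuclideanSpace ℝ (Fin d) → EuclideanSpace ℝ (Fin d)} {N : ℕ} (hNpos : 0 < N)
    (hO : ∀ i : ℕ, (fun x => f^[i] x) =O[𝓝 0] (fun x => x))
    (hN : ∀ᶠ x in 𝓝 (0 : EuclideanSpace ℝ (Fin d)), ‖f^[N] x‖ ≤ 1 / 2 * ‖x‖) :
    AsympStableAtZero f := by
  obtain ⟨δ, hδ, C, hC, h⟩ := exists_iterate_norm_le_geometric hO hN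
  have hdecay : ∀ x ∈ ball (0 : EuclideanSpace ℝ (Fin d)) δ, ∀ i : ℕ,
      ‖f^[i] x‖ ≤ C * (1 / 2) ^ (i / N) * ‖x‖ := fun x hx i => by
    simpa only [Nat.mod_add_div] using h x hx (i / N) (i % N) (Nat.mod_lt i hNpos)
  refine ⟨fun ε hε => ⟨min δ (ε / C), by positivity, fun x hx i => ?_⟩,
    δ, hδ, fun x hx => ?_⟩
  · rw [mem_ball_zero_iff, lt_min_iff] at hx
    rw [mem_ball_zero_iff]
    have hpow : ((1 : ℝ) / 2) ^ (i / N) ≤ 1 := pow_le_one₀ (by norm_num) (by norm_num)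
    calc ‖f^[i] x‖ ≤ C * (1 / 2) ^ (i / N) * ‖x‖ := hdecay x (by simpa using hx.1) i
      _ ≤ C * 1 * ‖x‖ := by gcongr
      _ < ε := by
        have := (lt_div_iff₀ hC).1 hx.2
        linarith
  · refine squeeze_zero_norm (hdecay x hx) ?_
    have hpow : Tendsto (fun i : ℕ => ((1 : ℝ) / 2) ^ (i / N)) atTop (𝓝 0) :=
      (tendsto_pow_atTop_nhds_zero_of_lt_one (by norm_num) (by norm_num)).comp
        (Nat.tendsto_div_const_atTop hNpos.ne')
    simpa using (hpow.const_mul C).mul_const ‖x‖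

/-- A map that is linear on each closed half-space `x i ≤ 0`, `0 ≤ x i` is Lipschitz. -/
theorem exists_lipschitzWith_of_piecewise_linear {d : ℕ} (i : Fin d)
    {g : EuclideanSpace ℝ (Fin d) → EuclideanSpace ℝ (Fin d)}
    (AL AR : EuclideanSpace ℝ (Fin d) →L[ℝ] EuclideanSpace ℝ (Fin d))
    (hg : ∀ x, (x i ≤ 0 → g x = AL x) ∧ (0 ≤ x i → g x = AR x)) :
    ∃ K, LipschitzWith K g := by
  set e : EuclideanSpace ℝ (Fin d) := EuclideanSpace.single i 1
  have hform : g = fun x => AL x + max (x i) 0 • (AR e - AL e) := by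
    funext x
    rcases le_total (x i) 0 with hx | hx
    · simp [(hg x).1 hx, max_eq_right hx]
    · have hy : (x - x i • e) i = 0 := by simp [e]
      have heq : AL (x - x i • e) = AR (x - x i • e) :=
        ((hg _).1 hy.le).symm.trans ((hg _).2 hy.ge)
      simp only [map_sub, map_smul] at heq
      rw [(hg x).2 hx, max_eq_left hx, smul_sub, ← sub_eq_zero]
      rw [← sub_eq_zero] at heq
      rw [← neg_eq_zero, ← heq]
      abel
  have hcoord : LipschitzWith 1 (fun x : EuclideanSpace ℝ (Fin d) => max (x i) 0) := by
    refine LipschitzWith.max_const (LipschitzWith.of_dist_le_mul fun x y => ?_) 0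
    simpa [dist_eq_norm] using PiLp.norm_apply_le (x - y) i
  have hsmul := ((ContinuousLinearMap.id ℝ ℝ).smulRight (AR e - AL e)).lipschitz.comp hcoord
  rw [hform]
  exact ⟨_, AL.lipschitz.add hsmul⟩

theorem stmt0 {d : ℕ} (hd : 0 < d)
    (fL fR f g : EuclideanSpace ℝ (Fin d) → EuclideanSpace ℝ (Fin d))
    (hfL : ContDiff ℝ 1 fL) (hfR : ContDiff ℝ 1 fR)
    (hagree : ∀ x : EuclideanSpace ℝ (Fin d), x ⟨0, hd⟩ = 0 → fL x = fR x)
    (hfdef : ∀ x : EuclideanSpace ℝ (Fin d),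
      (x ⟨0, hd⟩ ≤ 0 → f x = fL x) ∧ (0 ≤ x ⟨0, hd⟩ → f x = fR x))
    (hf0 : f 0 = 0)
    (hgdef : ∀ x : EuclideanSpace ℝ (Fin d),
      (x ⟨0, hd⟩ ≤ 0 → g x = fderiv ℝ fL 0 x) ∧ (0 ≤ x ⟨0, hd⟩ → g x = fderiv ℝ fR 0 x))
    (hstab : AsympStableAtZero g) :
    AsympStableAtZero f := by
  obtain ⟨K, hK⟩ := exists_lipschitzWith_of_piecewise_linear _ _ _ hgdef
  have hhom : ∀ c : ℝ, 0 ≤ c → ∀ x, g (c • x) = c • g x := fun c hc x => by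
    rcases le_total (x ⟨0, hd⟩) 0 with hx | hx
    · rw [(hgdef x).1 hx, (hgdef (c • x)).1 (by simpa using mul_nonpos_of_nonneg_of_nonpos hc hx),
        map_smul]
    · rw [(hgdef x).2 hx, (hgdef (c • x)).2 (by simpa using mul_nonneg hc hx), map_smul]
  have hg0 : g 0 = 0 := by simpa using hhom 0 le_rfl 0
  have hfL0 : fL 0 = 0 := by rw [← (hfdef 0).1 (by simp), hf0]
  have hfR0 : fR 0 = 0 := by rw [← (hfdef 0).2 (by simp), hf0]
  have hfg : (fun x => f x - g x) =o[𝓝 0] (fun x => x) := by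
    have hL := ((hfL.differentiable one_ne_zero) 0).hasFDerivAt.isLittleO
    have hR := ((hfR.differentiable one_ne_zero) 0).hasFDerivAt.isLittleO
    simp only [hfL0, hfR0, sub_zero] at hL hR
    refine IsLittleO.of_bound fun c hc => ?_
    filter_upwards [hL.bound hc, hR.bound hc] with x hxL hxR
    rcases le_total (x ⟨0, hd⟩) 0 with hx | hx
    · rwa [(hfdef x).1 hx, (hgdef x).1 hx]
    · rwa [(hfdef x).2 hx, (hgdef x).2 hx]
  obtain ⟨hlyap, δ, hδ, hattr⟩ := hstab
  obtain ⟨δ₁, hδ₁, hone⟩ := hlyap 1 one_pos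
  obtain ⟨M, hM, hbound⟩ := exists_iterate_norm_le_of_pos_homogeneous hhom hδ₁ hone
  obtain ⟨N, hNpos, hN⟩ :=
    exists_iterate_contracting_of_pos_homogeneous hK.continuous hhom hM hbound hδ hattr
  have hclose := isLittleO_iterate_sub_iterate hK hg0 hfg
  refine asympStableAtZero_of_iterate_contracting hNpos (fun i => (hclose i).2) ?_
  filter_upwards [(hclose N).1.bound (show (0 : ℝ) < 1 / 4 by norm_num)] with x hx
  have htri := norm_add_le (f^[N] x - g^[N] x) (g^[N] x)
  rw [sub_add_cancel] at htri
  linarith [hN x]
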